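/- Let (Ω, F, P) be a probability space, let ε be a real random variable whose law is the standard Gaussian N(0,1), and let ω be a random variable taking values in {0,1} that is independent of ε, with P(ω = 1) = p_{ηη} where 0 ≤ p_{ηη} ≤ 1. Let r, λ_E, λ_χ, μ, ψ, γˢ, ψˢ be real numbers, v > 0, and η > 0. Define ξ := -log E[exp(-λ_χ · ω)], the pricing kernel Λ := exp(-r - λ_E²/2 - λ_E · ε - λ_χ · ω + ξ), the risk-adjusted probability p̃_{ηη} := p_{ηη} · e^{-λ_χ} / (p_{ηη} · e^{-λ_χ} + (1 - p_{ηη})), and the risk-adjusted peg premium η̃ := -log(e^{η} - p̃_{ηη} · (e^{η} - 1)). If both Euler equations E[Λ · exp(ψ + μ + √v · ε)] = 1 and E[Λ · exp(γˢ + ψˢ + μ + √v · ε - η · ω + η)] = 1 hold, then ψˢ = ψ - γˢ + η̃. -/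

import Mathlib

open MeasureTheory ProbabilityTheory

/-- The exponential moment of a `{0, 1}`-valued random variable. -/
lemma integral_exp_mul_indicator
    {Ω : Type*} [MeasurableSpace Ω] {P : Measure Ω} [IsProbabilityMeasure P]
    {ω : Ω → ℝ} (hωm : Measurable ω) (hω01 : ∀ x, ω x = 0 ∨ ω x = 1)
    {p : ℝ} (hp0 : 0 ≤ p) (hPω : P {x | ω x = 1} = ENNReal.ofReal p) (a : ℝ) :
    ∫ x, Real.exp (a * ω x) ∂P = p * Real.exp a + (1 - p) := by
  have hS : MeasurableSet {x | ω x = 1} := hωm (measurableSet_singleton 1)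
  have hfun : (fun x => Real.exp (a * ω x)) =
      fun x => {x | ω x = 1}.indicator (fun _ => Real.exp a - 1) x + 1 := by
    funext x
    rcases hω01 x with h | h <;> simp [Set.indicator, h]
  rw [hfun, integral_add ((integrable_const _).indicator hS) (integrable_const _),
    integral_indicator_const _ hS]
  simp only [Measure.real, hPω, ENNReal.toReal_ofReal hp0, integral_const, measure_univ,
    ENNReal.toReal_one, smul_eq_mul]
  ring

/-- An exponential of an affine function of two independent variables has expectation equal to
the product of their exponential moments. -/
lemma integral_exp_affine_of_indepFun
    {Ω : Type*} [MeasurableSpace Ω] {P : Measure Ω} {X Y : Ω → ℝ}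
    (hX : Measurable X) (hY : Measurable Y) (hXY : IndepFun X Y P) (c a b : ℝ) :
    ∫ x, Real.exp (c + a * X x + b * Y x) ∂P =
      Real.exp c * ((∫ x, Real.exp (a * X x) ∂P) * ∫ x, Real.exp (b * Y x) ∂P) := by
  have hind : IndepFun (fun x => Real.exp (a * X x)) (fun x => Real.exp (b * Y x)) P :=
    hXY.comp (φ := fun t => Real.exp (a * t)) (ψ := fun t => Real.exp (b * t))
      (by fun_prop) (by fun_prop)
  rw [← hind.integral_fun_mul_eq_mul_integral (by fun_prop) (by fun_prop),
    ← integral_const_mul]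
  simp only [Real.exp_add, mul_assoc]

/-- Proposition 5 (stETH lending vs. ETH lending), de-peg state: if the Euler
equations hold for both the ETH lending return `exp(ψ + μ + √v ε)` and the
liquid-staking return `exp(γˢ + ψˢ + μ + √v ε - η ω + η)` under the pricing kernel
`Λ = exp(-r - λ_E²/2 - λ_E ε - λ_χ ω + ξ)`, then `ψˢ = ψ - γˢ + η̃`. -/
theorem steth_vs_lending_depeg
    {Ω : Type*} [MeasurableSpace Ω] (P : Measure Ω) [IsProbabilityMeasure P]
    (ε ω : Ω → ℝ) (hεm : Measurable ε) (hωm : Measurable ω)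
    (hεlaw : Measure.map ε P = gaussianReal 0 1)
    (hω01 : ∀ x, ω x = 0 ∨ ω x = 1)
    (hindep : IndepFun ε ω P)
    (pηη : ℝ) (hp0 : 0 ≤ pηη) (hp1 : pηη ≤ 1)
    (hPω : P {x | ω x = 1} = ENNReal.ofReal pηη)
    (r lamE lamχ μ ψ γs ψs v η : ℝ) (hv : 0 < v) (hη : 0 < η)
    (ξ : ℝ) (hξ : ξ = -Real.log (∫ x, Real.exp (-lamχ * ω x) ∂P))
    (Λ : Ω → ℝ)
    (hΛ : ∀ x, Λ x = Real.exp (-r - lamE ^ 2 / 2 - lamE * ε x - lamχ * ω x + ξ))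
    (ptilde : ℝ)
    (hpt : ptilde = pηη * Real.exp (-lamχ) / (pηη * Real.exp (-lamχ) + (1 - pηη)))
    (ηtilde : ℝ)
    (hηt : ηtilde = -Real.log (Real.exp η - ptilde * (Real.exp η - 1)))
    (hEuler1 : ∫ x, Λ x * Real.exp (ψ + μ + Real.sqrt v * ε x) ∂P = 1)
    (hEuler2 :
      ∫ x, Λ x * Real.exp (γs + ψs + μ + Real.sqrt v * ε x - η * ω x + η) ∂P = 1) :
    ψs = ψ - γs + ηtilde := by
  have h1 : ∀ x, Λ x * Real.exp (ψ + μ + Real.sqrt v * ε x) =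
      Real.exp ((-r - lamE ^ 2 / 2 + ξ + μ + ψ) + (Real.sqrt v - lamE) * ε x
        + (-lamχ) * ω x) := fun x => by
    rw [hΛ, ← Real.exp_add]; ring_nf
  have h2 : ∀ x, Λ x * Real.exp (γs + ψs + μ + Real.sqrt v * ε x - η * ω x + η) =
      Real.exp ((-r - lamE ^ 2 / 2 + ξ + μ + (γs + ψs + η)) + (Real.sqrt v - lamE) * ε x
        + (-lamχ - η) * ω x) := fun x => by
    rw [hΛ, ← Real.exp_add]; ring_nf
  simp only [h1] at hEuler1
  simp only [h2] at hEuler2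
  rw [integral_exp_affine_of_indepFun hεm hωm hindep,
    integral_exp_mul_indicator hωm hω01 hp0 hPω, Real.exp_add] at hEuler1 hEuler2
  set C := Real.exp (-r - lamE ^ 2 / 2 + ξ + μ)
  set G := ∫ x, Real.exp ((Real.sqrt v - lamE) * ε x) ∂P
  have hCG : C * G ≠ 0 := by
    intro h
    have : C * G * (Real.exp ψ * (pηη * Real.exp (-lamχ) + (1 - pηη))) = 1 := by
      linear_combination hEuler1
    simp [h] at this
  have hE : Real.exp (-lamχ - η) * Real.exp η = Real.exp (-lamχ) := by
    rw [← Real.exp_add]; ring_nf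
  have hDpos : 0 < pηη * Real.exp (-lamχ) + (1 - pηη) := by
    rcases hp0.eq_or_lt with h | h
    · simp [← h]
    · have := mul_pos h (Real.exp_pos (-lamχ))
      linarith
  have key : Real.exp ψ * (pηη * Real.exp (-lamχ) + (1 - pηη)) =
      Real.exp (γs + ψs) * (pηη * Real.exp (-lamχ) + (1 - pηη) * Real.exp η) := by
    apply mul_left_cancel₀ hCG
    rw [Real.exp_add (γs + ψs) η] at hEuler2
    linear_combination hEuler1 - hEuler2 + C * G * Real.exp (γs + ψs) * pηη * hE
  have hK : Real.exp η - ptilde * (Real.exp η - 1) = Real.exp (ψ - (γs + ψs)) := by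
    rw [Real.exp_sub, hpt]
    field_simp
    linear_combination -key
  rw [hηt, hK, Real.log_exp]
  ring
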